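/- arXiv:math/0604415 — 2 statements merged into one kernel-verified Lean document; each statement's English description precedes it below -/
import Mathlib

section
/- Let a : ℝ → ℝ be C² and define f(x,y) = a(x)/(x² + y²) on the upper half-plane {(x,y) ∈ ℝ² : y > 0}. Then f satisfies the minimal surface equation in H²×ℝ at a point (x,y) of the upper half-plane if and only if [(x² + y²)⁴ + 4 y⁴ a(x)²]·a''(x) − 4 (x² + y²)³·[x·a'(x) − a(x)] = 0. -/
open Real MeasureTheory

/-- Partial derivative in the first variable. -/
noncomputable def px (f : ℝ → ℝ → ℝ) (x y : ℝ) : ℝ := deriv (fun t => f t y) x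

/-- Partial derivative in the second variable. -/
noncomputable def py (f : ℝ → ℝ → ℝ) (x y : ℝ) : ℝ := deriv (fun t => f x t) y

/-- Left-hand side of the minimal surface equation in `ℍ² × ℝ` (upper half-plane model):
`(1 + y² f_y²) f_xx − y (f_x² + f_y²) f_y − 2 y² f_x f_y f_xy + (1 + y² f_x²) f_yy`. -/
noncomputable def minExpr (f : ℝ → ℝ → ℝ) (x y : ℝ) : ℝ :=
  (1 + y ^ 2 * (py f x y) ^ 2) * px (px f) x y
    - y * ((px f x y) ^ 2 + (py f x y) ^ 2) * py f x y
    - 2 * y ^ 2 * px f x y * py f x y * py (px f) x y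
    + (1 + y ^ 2 * (px f x y) ^ 2) * py (py f) x y

/-- The minimal surface equation in `ℍ² × ℝ`. -/
def MinimalEq (f : ℝ → ℝ → ℝ) (x y : ℝ) : Prop := minExpr f x y = 0

private lemma sq_add_sq_ne_zero (x : ℝ) {y : ℝ} (hy : 0 < y) : x ^ 2 + y ^ 2 ≠ 0 := by
  positivity

private lemma hasDerivAt_sq_add_const (x c : ℝ) :
    HasDerivAt (fun t : ℝ => t ^ 2 + c) (2 * x) x := by
  simpa using (hasDerivAt_pow 2 x).add_const c

private lemma hasDerivAt_const_add_sq (c y : ℝ) :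
    HasDerivAt (fun t : ℝ => c + t ^ 2) (2 * y) y := by
  simpa using (hasDerivAt_pow 2 y).const_add c

lemma px_div_sq_add_sq {a : ℝ → ℝ} {x y : ℝ} (ha : DifferentiableAt ℝ a x) (hy : 0 < y) :
    px (fun x y => a x / (x ^ 2 + y ^ 2)) x y =
      (deriv a x * (x ^ 2 + y ^ 2) - a x * (2 * x)) / (x ^ 2 + y ^ 2) ^ 2 :=
  (ha.hasDerivAt.div (hasDerivAt_sq_add_const x _) (sq_add_sq_ne_zero x hy)).deriv

lemma py_div_sq_add_sq (a : ℝ → ℝ) (x : ℝ) {y : ℝ} (hy : 0 < y) :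
    py (fun x y => a x / (x ^ 2 + y ^ 2)) x y = -(a x * (2 * y)) / (x ^ 2 + y ^ 2) ^ 2 := by
  have h := (hasDerivAt_const y (a x)).div (hasDerivAt_const_add_sq (x ^ 2) y)
    (sq_add_sq_ne_zero x hy)
  exact h.deriv.trans (by ring)

lemma px_px_div_sq_add_sq {a : ℝ → ℝ} {x y : ℝ} (ha : Differentiable ℝ a)
    (ha' : DifferentiableAt ℝ (deriv a) x) (hy : 0 < y) :
    px (px (fun x y => a x / (x ^ 2 + y ^ 2))) x y =
      (deriv (deriv a) x * (x ^ 2 + y ^ 2) ^ 2 - 4 * x * deriv a x * (x ^ 2 + y ^ 2)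
        - 2 * a x * (x ^ 2 + y ^ 2) + 8 * x ^ 2 * a x) / (x ^ 2 + y ^ 2) ^ 3 := by
  have hr := sq_add_sq_ne_zero x hy
  have hq := hasDerivAt_sq_add_const x (y ^ 2)
  have h := ((ha'.hasDerivAt.mul hq).sub
    ((ha x).hasDerivAt.mul ((hasDerivAt_id x).const_mul 2))).div (hq.pow 2) (pow_ne_zero 2 hr)
  have hf : (fun t => px (fun x y => a x / (x ^ 2 + y ^ 2)) t y) = fun t =>
      (deriv a t * (t ^ 2 + y ^ 2) - a t * (2 * t)) / (t ^ 2 + y ^ 2) ^ 2 :=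
    funext fun t => px_div_sq_add_sq (ha t) hy
  rw [px, hf]
  refine h.deriv.trans ?_
  simp only [Pi.mul_apply, Pi.sub_apply, Pi.pow_apply, id]
  field_simp
  ring

lemma py_px_div_sq_add_sq {a : ℝ → ℝ} {x y : ℝ} (ha : DifferentiableAt ℝ a x) (hy : 0 < y) :
    py (px (fun x y => a x / (x ^ 2 + y ^ 2))) x y =
      (8 * x * y * a x - 2 * y * deriv a x * (x ^ 2 + y ^ 2)) / (x ^ 2 + y ^ 2) ^ 3 := by
  have hr := sq_add_sq_ne_zero x hy
  have hq := hasDerivAt_const_add_sq (x ^ 2) y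
  have h := ((hq.const_mul (deriv a x)).sub_const (a x * (2 * x))).div (hq.pow 2)
    (pow_ne_zero 2 hr)
  have hf : (fun t => px (fun x y => a x / (x ^ 2 + y ^ 2)) x t) =ᶠ[nhds y] fun t =>
      (deriv a x * (x ^ 2 + t ^ 2) - a x * (2 * x)) / (x ^ 2 + t ^ 2) ^ 2 := by
    filter_upwards [lt_mem_nhds hy] with t ht using px_div_sq_add_sq ha ht
  rw [py, hf.deriv_eq]
  refine h.deriv.trans ?_
  simp only [Pi.pow_apply]
  field_simp
  ring

lemma py_py_div_sq_add_sq (a : ℝ → ℝ) (x : ℝ) {y : ℝ} (hy : 0 < y) :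
    py (py (fun x y => a x / (x ^ 2 + y ^ 2))) x y =
      (8 * y ^ 2 * a x - 2 * a x * (x ^ 2 + y ^ 2)) / (x ^ 2 + y ^ 2) ^ 3 := by
  have hr := sq_add_sq_ne_zero x hy
  have hq := hasDerivAt_const_add_sq (x ^ 2) y
  have h := (((hasDerivAt_id y).const_mul 2).const_mul (a x)).neg.div (hq.pow 2)
    (pow_ne_zero 2 hr)
  have hf : (fun t => py (fun x y => a x / (x ^ 2 + y ^ 2)) x t) =ᶠ[nhds y] fun t =>
      -(a x * (2 * t)) / (x ^ 2 + t ^ 2) ^ 2 := by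
    filter_upwards [lt_mem_nhds hy] with t ht using py_div_sq_add_sq a x ht
  rw [py, hf.deriv_eq]
  refine h.deriv.trans ?_
  simp only [Pi.neg_apply, Pi.pow_apply, id]
  field_simp
  ring

lemma minExpr_div_sq_add_sq {a : ℝ → ℝ} {x y : ℝ} (ha : Differentiable ℝ a)
    (ha' : DifferentiableAt ℝ (deriv a) x) (hy : 0 < y) :
    minExpr (fun x y => a x / (x ^ 2 + y ^ 2)) x y =
      (((x ^ 2 + y ^ 2) ^ 4 + 4 * y ^ 4 * (a x) ^ 2) * deriv (deriv a) x
        - 4 * (x ^ 2 + y ^ 2) ^ 3 * (x * deriv a x - a x)) / (x ^ 2 + y ^ 2) ^ 5 := by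
  have hr := sq_add_sq_ne_zero x hy
  rw [minExpr, px_px_div_sq_add_sq ha ha' hy, py_px_div_sq_add_sq (ha x) hy,
    py_py_div_sq_add_sq a x hy, px_div_sq_add_sq (ha x) hy, py_div_sq_add_sq a x hy]
  field_simp
  ring

/-- `f(x,y) = a(x)/(x² + y²)` solves the minimal surface equation in `ℍ² × ℝ` at `(x,y)`
iff `[(x² + y²)⁴ + 4 y⁴ a(x)²] a''(x) − 4 (x² + y²)³ [x a'(x) − a(x)] = 0`. -/
theorem minimal_graph_a_over_r2
    (a : ℝ → ℝ) (ha : ContDiff ℝ 2 a) :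
    ∀ x y : ℝ, 0 < y →
      (MinimalEq (fun x y => a x / (x ^ 2 + y ^ 2)) x y ↔
        ((x ^ 2 + y ^ 2) ^ 4 + 4 * y ^ 4 * (a x) ^ 2) * deriv (deriv a) x
          - 4 * (x ^ 2 + y ^ 2) ^ 3 * (x * deriv a x - a x) = 0) := by
  intro x y hy
  have ha' : Differentiable ℝ (deriv a) :=
    (ContDiff.deriv' (n := 1) (by simpa [one_add_one_eq_two] using ha)).differentiable one_ne_zero
  rw [MinimalEq, minExpr_div_sq_add_sq (ha.differentiable two_ne_zero) (ha' x) hy,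
    div_eq_zero_iff, or_iff_left (pow_ne_zero 5 (sq_add_sq_ne_zero x hy))]
end

section
/- Let c₁, c₂, c₃, c ∈ ℝ with j := 1 − c₂² − 2 c₁ c₃ > 0, set λ(x,y) = (1/y)·[(c₁/2)(x² + y²) + c₂ x − c₃], and define f(x,y) = arctan(λ(x,y)/√(j − λ(x,y)²)) + c on the open set U of points of the upper half-plane where j − λ(x,y)² > 0. Then for all (x,y) ∈ U: √(y²(f_x(x,y)² + f_y(x,y)²) + 1) = 1/√(j − λ(x,y)²); equivalently, with w = √(y²(f_x² + f_y²) + 1)/y², one has y² w = 1/√(j − λ²). -/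
open Real MeasureTheory

/-- For `j > g²`, the function `arctan (g / √(j - g²)) + c` has derivative `g' / √(j - g²)`. -/
theorem hasDerivAt_arctan_div_sqrt_sub_sq {g : ℝ → ℝ} {g' t : ℝ} (j c : ℝ)
    (hg : HasDerivAt g g' t) (hpos : 0 < j - g t ^ 2) :
    HasDerivAt (fun s => arctan (g s / √(j - g s ^ 2)) + c) (g' / √(j - g t ^ 2)) t := by
  have hs : 0 < √(j - g t ^ 2) := sqrt_pos.mpr hpos
  have hsq : √(j - g t ^ 2) ^ 2 = j - g t ^ 2 := sq_sqrt hpos.le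
  have hroot := ((hg.pow 2).const_sub j).sqrt hpos.ne'
  refine ((hg.div hroot hs.ne').arctan.add_const c).congr_deriv ?_
  have hj : 0 < √(j - g t ^ 2) ^ 2 + g t ^ 2 := by positivity
  simp only [Pi.div_apply, Pi.pow_apply]
  generalize √(j - g t ^ 2) = r at *
  field_simp
  ring

/-- For the umbilical graph `f = arctan(λ/√(j − λ²)) + c` with
`λ(x,y) = (1/y)((c₁/2)(x² + y²) + c₂ x − c₃)` and `j = 1 − c₂² − 2 c₁ c₃ > 0`, one has
`√(y²(f_x² + f_y²) + 1) = 1/√(j − λ²)` wherever `j − λ² > 0` in the upper half-plane. -/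
theorem umbilic_graph_w_identity
    (c₁ c₂ c₃ c : ℝ) (hj : 1 - c₂ ^ 2 - 2 * c₁ * c₃ > 0)
    (lam : ℝ → ℝ → ℝ)
    (hlam : ∀ x y : ℝ, lam x y = (1 / y) * (c₁ / 2 * (x ^ 2 + y ^ 2) + c₂ * x - c₃))
    (f : ℝ → ℝ → ℝ)
    (hf : ∀ x y : ℝ, f x y = Real.arctan (lam x y
        / Real.sqrt ((1 - c₂ ^ 2 - 2 * c₁ * c₃) - lam x y ^ 2)) + c) :
    ∀ x y : ℝ, 0 < y → (1 - c₂ ^ 2 - 2 * c₁ * c₃) - lam x y ^ 2 > 0 →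
      Real.sqrt (y ^ 2 * ((px f x y) ^ 2 + (py f x y) ^ 2) + 1)
        = 1 / Real.sqrt ((1 - c₂ ^ 2 - 2 * c₁ * c₃) - lam x y ^ 2) := by
  intro x y hy hpos
  have hx : HasDerivAt (fun t => lam t y) ((c₁ * x + c₂) / y) x := by
    simp only [hlam]
    refine ((((((hasDerivAt_id x).pow 2).add_const (y ^ 2)).const_mul (c₁ / 2)).add
      ((hasDerivAt_id x).const_mul c₂)).sub_const c₃ |>.const_mul (1 / y)).congr_deriv ?_
    simp
    field_simp
  have hyd : HasDerivAt (fun t => lam x t)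
      (c₁ / 2 - (c₁ / 2 * x ^ 2 + c₂ * x - c₃) / y ^ 2) y := by
    simp only [hlam, one_div]
    refine ((hasDerivAt_inv hy.ne').mul
      (((((hasDerivAt_id y).pow 2).const_add (x ^ 2)).const_mul (c₁ / 2)).add_const
        (c₂ * x) |>.sub_const c₃)).congr_deriv ?_
    simp
    field_simp
    ring
  have hpx : px f x y = (c₁ * x + c₂) / y / √(1 - c₂ ^ 2 - 2 * c₁ * c₃ - lam x y ^ 2) := by
    simp only [px, hf]
    exact (hasDerivAt_arctan_div_sqrt_sub_sq _ c hx hpos).deriv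
  have hpy : py f x y = (c₁ / 2 - (c₁ / 2 * x ^ 2 + c₂ * x - c₃) / y ^ 2)
      / √(1 - c₂ ^ 2 - 2 * c₁ * c₃ - lam x y ^ 2) := by
    simp only [py, hf]
    exact (hasDerivAt_arctan_div_sqrt_sub_sq _ c hyd hpos).deriv
  rw [hpx, hpy, ← sqrt_one, ← sqrt_div zero_le_one, sqrt_one,
    div_pow _ √_, div_pow _ √_, sq_sqrt hpos.le]
  congr 1
  have key : y ^ 2 * (((c₁ * x + c₂) / y) ^ 2
      + (c₁ / 2 - (c₁ / 2 * x ^ 2 + c₂ * x - c₃) / y ^ 2) ^ 2)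
      + (1 - c₂ ^ 2 - 2 * c₁ * c₃ - lam x y ^ 2) = 1 := by
    rw [hlam]
    field_simp
    ring
  rw [← add_div, mul_div_assoc', div_add_one hpos.ne', key]
end
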